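/- Let $B=(b_{ij})$ be an $L\times L$ real matrix with all entries positive and let $c\in\mathbb{R}^L$ have all entries positive. Define the map $T$ on positive vectors by $T_l(z) = c_l\Big/\Big(\sum_{i=1}^L c_i\, b_{il}\big/\big(\sum_{j=1}^L b_{ij}z_j\big)\Big)$. Then each component $T_l$ is concave on the convex set of entrywise-positive vectors: for all entrywise-positive $z,z'\in\mathbb{R}^L$ and all $\theta\in[0,1]$, $T_l(\theta z + (1-\theta)z') \ge \theta\,T_l(z) + (1-\theta)\,T_l(z')$. -/

import Mathlib

open Matrix BigOperators

/-- The iteration map `T_l(z) = c_l / (∑ i, c_i b_{il} / (∑ j, b_{ij} z_j))` of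
Lemma 1 / Algorithm 1. -/
noncomputable def Tmap {L : ℕ} (B : Matrix (Fin L) (Fin L) ℝ) (c : Fin L → ℝ)
    (z : Fin L → ℝ) (l : Fin L) : ℝ :=
  c l / (∑ i, c i * B i l / (∑ j, B i j * z j))

/-- Joint convexity of `(x, u) ↦ x ^ 2 / u` on `u > 0`. -/
theorem sq_div_convex_comb_le {θ u v α β : ℝ} (h0 : 0 ≤ θ) (h1 : θ ≤ 1) (hu : 0 < u)
    (hv : 0 < v) :
    (θ * α + (1 - θ) * β) ^ 2 / (θ * u + (1 - θ) * v) ≤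
      θ * (α ^ 2 / u) + (1 - θ) * (β ^ 2 / v) := by
  have hw : 0 < θ * u + (1 - θ) * v := by
    rcases h0.eq_or_lt with rfl | h
    · simpa using hv
    · have := mul_pos h hu
      have := mul_nonneg (sub_nonneg.2 h1) hv.le
      linarith
  have key : θ * (α ^ 2 / u) + (1 - θ) * (β ^ 2 / v) -
      (θ * α + (1 - θ) * β) ^ 2 / (θ * u + (1 - θ) * v) =
      θ * (1 - θ) * (α * v - β * u) ^ 2 / (u * v * (θ * u + (1 - θ) * v)) := by
    field_simp
    ring
  have : 0 ≤ θ * (1 - θ) * (α * v - β * u) ^ 2 / (u * v * (θ * u + (1 - θ) * v)) := by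
    have := sub_nonneg.2 h1
    positivity
  linarith

/-- Weighted harmonic sums `u ↦ (∑ i, a i / u i)⁻¹` are concave on positive vectors. -/
theorem inv_sum_div_concave {ι : Type*} [Fintype ι] [Nonempty ι] {a u v : ι → ℝ} {θ : ℝ}
    (ha : ∀ i, 0 < a i) (hu : ∀ i, 0 < u i) (hv : ∀ i, 0 < v i) (h0 : 0 ≤ θ) (h1 : θ ≤ 1) :
    θ * (∑ i, a i / u i)⁻¹ + (1 - θ) * (∑ i, a i / v i)⁻¹ ≤
      (∑ i, a i / (θ * u i + (1 - θ) * v i))⁻¹ := by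
  have hS : 0 < ∑ i, a i / u i :=
    Finset.sum_pos (fun i _ => div_pos (ha i) (hu i)) Finset.univ_nonempty
  have hS' : 0 < ∑ i, a i / v i :=
    Finset.sum_pos (fun i _ => div_pos (ha i) (hv i)) Finset.univ_nonempty
  have hW : 0 < ∑ i, a i / (θ * u i + (1 - θ) * v i) :=
    Finset.sum_pos (fun i _ => div_pos (ha i)
      (convex_Ioi (0 : ℝ) (hu i) (hv i) h0 (sub_nonneg.2 h1) (by ring)))
      Finset.univ_nonempty
  set α := (∑ i, a i / u i)⁻¹
  set β := (∑ i, a i / v i)⁻¹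
  have hp : 0 < θ * α + (1 - θ) * β :=
    convex_Ioi (0 : ℝ) (inv_pos.2 hS) (inv_pos.2 hS') h0 (sub_nonneg.2 h1) (by ring)
  have hsum : (θ * α + (1 - θ) * β) ^ 2 * ∑ i, a i / (θ * u i + (1 - θ) * v i) ≤
      θ * α + (1 - θ) * β := by
    calc (θ * α + (1 - θ) * β) ^ 2 * ∑ i, a i / (θ * u i + (1 - θ) * v i)
        = ∑ i, a i * ((θ * α + (1 - θ) * β) ^ 2 / (θ * u i + (1 - θ) * v i)) := by
          rw [Finset.mul_sum]
          exact Finset.sum_congr rfl fun i _ => by ring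
      _ ≤ ∑ i, a i * (θ * (α ^ 2 / u i) + (1 - θ) * (β ^ 2 / v i)) :=
          Finset.sum_le_sum fun i _ => mul_le_mul_of_nonneg_left
            (sq_div_convex_comb_le h0 h1 (hu i) (hv i)) (ha i).le
      _ = θ * α ^ 2 * ∑ i, a i / u i + (1 - θ) * β ^ 2 * ∑ i, a i / v i := by
          rw [Finset.mul_sum, Finset.mul_sum, ← Finset.sum_add_distrib]
          exact Finset.sum_congr rfl fun i _ => by ring
      _ = θ * α + (1 - θ) * β := by
          have e1 : α * ∑ i, a i / u i = 1 := inv_mul_cancel₀ hS.ne'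
          have e2 : β * ∑ i, a i / v i = 1 := inv_mul_cancel₀ hS'.ne'
          linear_combination θ * α * e1 + (1 - θ) * β * e2
  rw [← one_div, le_div_iff₀ hW]
  refine le_of_mul_le_mul_left ?_ hp
  linarith

/-- Each component of the iteration map `T` is concave on the cone of entrywise-positive
vectors. -/
theorem stmt3 {L : ℕ} (B : Matrix (Fin L) (Fin L) ℝ) (c : Fin L → ℝ)
    (hB : ∀ i j, 0 < B i j) (hc : ∀ i, 0 < c i) :
    ∀ z z' : Fin L → ℝ, (∀ j, 0 < z j) → (∀ j, 0 < z' j) →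
      ∀ θ : ℝ, θ ∈ Set.Icc (0 : ℝ) 1 →
        ∀ l, θ * Tmap B c z l + (1 - θ) * Tmap B c z' l ≤
          Tmap B c (fun j => θ * z j + (1 - θ) * z' j) l := by
  intro z z' hz hz' θ hθ l
  have : Nonempty (Fin L) := ⟨l⟩
  have hpos : ∀ w : Fin L → ℝ, (∀ j, 0 < w j) → ∀ i, 0 < ∑ j, B i j * w j := fun w hw i =>
    Finset.sum_pos (fun j _ => mul_pos (hB i j) (hw j)) Finset.univ_nonempty
  have hlin : ∀ i, ∑ j, B i j * (θ * z j + (1 - θ) * z' j) =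
      θ * ∑ j, B i j * z j + (1 - θ) * ∑ j, B i j * z' j := fun i => by
    rw [Finset.mul_sum, Finset.mul_sum, ← Finset.sum_add_distrib]
    exact Finset.sum_congr rfl fun j _ => by ring
  have h := mul_le_mul_of_nonneg_left
    (inv_sum_div_concave (fun i => mul_pos (hc i) (hB i l)) (hpos z hz) (hpos z' hz')
      hθ.1 hθ.2) (hc l).le
  simp only [Tmap, hlin, div_eq_mul_inv (c l)]
  linarith
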